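/- Let (X,d) be a compact metric space, f : X → X continuous with h_top(f) < +∞, and ψ ∈ C(X,ℝ) with ψ > 0. Fix μ ∈ M(X,f). If there exists φ ∈ C(X,ℝ) such that μ is an equilibrium state of P_ψ(φ) and h_μ(f) = 0, then μ is an equilibrium state of P_ψ(βφ) for every β ≥ 1. -/

import Mathlib

open Filter Set Topology MeasureTheory ENNReal

variable {X : Type*}

/-- Birkhoff sum `S_n φ = ∑_{i<n} φ ∘ f^i`. -/
def birkhoff (f : X → X) (φ : X → ℝ) (n : ℕ) (x : X) : ℝ :=
  ∑ i ∈ Finset.range n, φ (f^[i] x)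

section Metric
variable [MetricSpace X]

/-- `F` is an `(n,ε)`-spanning set of `Z`: every `y ∈ Z` is within Bowen distance
`d_n ≤ ε` of some point of `F`. -/
def IsSpanningSetOf (f : X → X) (n : ℕ) (ε : ℝ) (Z : Set X) (F : Finset X) : Prop :=
  ∀ y ∈ Z, ∃ x ∈ F, ∀ i < n, dist (f^[i] x) (f^[i] y) ≤ ε

/-- `E` is an `(n,ε)`-separated set of `Z`: `E ⊆ Z` and distinct points of `E` are at
Bowen distance `d_n > ε`. -/
def IsSeparatedSetOf (f : X → X) (n : ℕ) (ε : ℝ) (Z : Set X) (E : Finset X) : Prop :=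
  (E : Set X) ⊆ Z ∧ ∀ x ∈ E, ∀ y ∈ E, x ≠ y → ∃ i < n, ε < dist (f^[i] x) (f^[i] y)

/-- `S_T = {n : ℕ | ∃ x, S_nψ(x) ≤ T < S_{n+1}ψ(x)}`. -/
def inducedST (f : X → X) (ψ : X → ℝ) (T : ℝ) : Set ℕ :=
  {n | ∃ x : X, birkhoff f ψ n x ≤ T ∧ T < birkhoff f ψ (n + 1) x}

/-- `X_n = {x | S_nψ(x) ≤ T < S_{n+1}ψ(x)}`. -/
def inducedXn (f : X → X) (ψ : X → ℝ) (T : ℝ) (n : ℕ) : Set X :=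
  {x | birkhoff f ψ n x ≤ T ∧ T < birkhoff f ψ (n + 1) x}

/-- `Q_{ψ,T}(f,φ,ε)`: infimum over families of `(n,ε)`-spanning sets of the `X_n`, `n ∈ S_T`,
of `∑_{n ∈ S_T} ∑_{x ∈ F_n} e^{S_nφ(x)}`. -/
noncomputable def inducedQ (f : X → X) (ψ φ : X → ℝ) (T ε : ℝ) : ℝ≥0∞ :=
  ⨅ (F : ℕ → Finset X) (_ : ∀ n ∈ inducedST f ψ T,
      IsSpanningSetOf f n ε (inducedXn f ψ T n) (F n)),
    ∑' n : inducedST f ψ T, ∑ x ∈ F n, ENNReal.ofReal (Real.exp (birkhoff f φ n x))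

/-- `P_{ψ,T}(f,φ,ε)`: supremum over families of `(n,ε)`-separated sets of the `X_n`, `n ∈ S_T`,
of `∑_{n ∈ S_T} ∑_{x ∈ E_n} e^{S_nφ(x)}`. -/
noncomputable def inducedPsep (f : X → X) (ψ φ : X → ℝ) (T ε : ℝ) : ℝ≥0∞ :=
  ⨆ (E : ℕ → Finset X) (_ : ∀ n ∈ inducedST f ψ T,
      IsSeparatedSetOf f n ε (inducedXn f ψ T n) (E n)),
    ∑' n : inducedST f ψ T, ∑ x ∈ E n, ENNReal.ofReal (Real.exp (birkhoff f φ n x))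

/-- The ψ-induced topological pressure
`P_ψ(φ) = lim_{ε→0⁺} limsup_{T→∞} (1/T) log Q_{ψ,T}(f,φ,ε)`, the limit as `ε → 0⁺`
being realized as a `limsup` along `𝓝[>] 0` (since `ε ↦ limsup_T …` is monotone,
this coincides with the limit). -/
noncomputable def inducedPressure (f : X → X) (ψ φ : X → ℝ) : EReal :=
  limsup (fun ε : ℝ =>
    limsup (fun T : ℝ => ENNReal.log (inducedQ f ψ φ T ε) * ((T⁻¹ : ℝ) : EReal)) atTop)
    (𝓝[>] (0 : ℝ))

/-- Topological entropy `h_top(f) = P_ψ(0)` with `ψ ≡ 1`. -/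
noncomputable def topEntropy (f : X → X) : EReal :=
  inducedPressure f (fun _ => 1) (fun _ => 0)

end Metric
section Meas
variable [MetricSpace X] [MeasurableSpace X] [BorelSpace X]

/-- Entropy of the finite measurable partition of `X` induced by a map `q` into a finite
type: `H(q) = ∑_s -μ(q⁻¹{s}) log μ(q⁻¹{s})`. -/
noncomputable def mapEntropy {S : Type*} [Fintype S] (μ : Measure X) (q : X → S) : ℝ :=
  ∑ s : S, Real.negMulLog ((μ (q ⁻¹' {s})).toReal)

/-- Kolmogorov–Sinai (measure-theoretic) entropy `h_μ(f)`: the supremum, over finite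
measurable partitions (encoded as measurable maps `p : X → Fin k`), of
`lim_n (1/n) H(⋁_{i<n} f^{-i} p)`; the limit exists by subadditivity and is
realized here as a `liminf`. -/
noncomputable def measEntropy (f : X → X) (μ : Measure X) : EReal :=
  ⨆ (k : ℕ) (p : X → Fin k) (_ : Measurable p),
    liminf (fun n : ℕ =>
      (((n : ℝ)⁻¹ * mapEntropy μ (fun x (i : Fin n) => p (f^[i] x)) : ℝ) : EReal)) atTop

/-- The set `M(X,f)` of `f`-invariant Borel probability measures on `X`. -/
def invMeasures (f : X → X) : Set (Measure X) :=
  {μ | IsProbabilityMeasure μ ∧ ∀ B : Set X, MeasurableSet B → μ (f ⁻¹' B) = μ B}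

/-- `μ` is an equilibrium state of `P_ψ(φ)`:
`μ ∈ M(X,f)` and `P_ψ(φ) = (h_μ(f) + ∫φ dμ)/(∫ψ dμ)`. -/
noncomputable def equilibriumStates (f : X → X) (ψ φ : X → ℝ) : Set (Measure X) :=
  {μ | μ ∈ invMeasures f ∧
    inducedPressure f ψ φ =
      (measEntropy f μ + ((∫ x, φ x ∂μ : ℝ) : EReal)) / (((∫ x, ψ x ∂μ : ℝ) : EReal))}

end Meas

section Freeze
variable [MetricSpace X] [MeasurableSpace X] [BorelSpace X]

/-- `Max^ψ(φ) = sup_{μ ∈ M(X,f)} (∫φ dμ)/(∫ψ dμ)`. -/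
noncomputable def maxRatio (f : X → X) (ψ φ : X → ℝ) : ℝ :=
  ⨆ ν : invMeasures f, (∫ x, φ x ∂(ν : Measure X)) / (∫ x, ψ x ∂(ν : Measure X))

/-- `M_max^ψ(φ) = {μ ∈ M(X,f) : (∫φ dμ)/(∫ψ dμ) = Max^ψ(φ)}`. -/
def maxSet (f : X → X) (ψ φ : X → ℝ) : Set (Measure X) :=
  {μ ∈ invMeasures f |
    (∫ x, φ x ∂μ) / (∫ x, ψ x ∂μ) = maxRatio f ψ φ}

/-- `h_∞^ψ(φ) = sup{h_μ(f)/(∫ψ dμ) : μ ∈ M_max^ψ(φ)}`. -/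
noncomputable def hInfty (f : X → X) (ψ φ : X → ℝ) : EReal :=
  ⨆ μ : maxSet f ψ φ, measEntropy f (μ : Measure X) / (((∫ x, ψ x ∂(μ : Measure X) : ℝ)) : EReal)

end Freeze

section Helpers

lemma ENNReal.sum_rpow_le_rpow_sum_of_one_le {ι : Type*} (s : Finset ι) (g : ι → ℝ≥0∞) {β : ℝ}
    (hβ : 1 ≤ β) : ∑ i ∈ s, g i ^ β ≤ (∑ i ∈ s, g i) ^ β := by
  classical
  induction s using Finset.induction_on with
  | empty => simp
  | insert a s ha ih =>
    rw [Finset.sum_insert ha, Finset.sum_insert ha]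
    exact (add_le_add_right ih _).trans (ENNReal.add_rpow_le_rpow_add _ _ hβ)

lemma ENNReal.tsum_rpow_le_rpow_tsum_of_one_le {ι : Type*} (g : ι → ℝ≥0∞) {β : ℝ}
    (hβ : 1 ≤ β) : ∑' i, g i ^ β ≤ (∑' i, g i) ^ β := by
  rw [ENNReal.tsum_eq_iSup_sum]
  exact iSup_le fun s => (ENNReal.sum_rpow_le_rpow_sum_of_one_le s g hβ).trans
    (ENNReal.rpow_le_rpow (ENNReal.sum_le_tsum s) (zero_le_one.trans hβ))

lemma birkhoff_const_mul (f : X → X) (φ : X → ℝ) (β : ℝ) (n : ℕ) (x : X) :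
    birkhoff f (fun y => β * φ y) n x = β * birkhoff f φ n x := by
  simp only [birkhoff, Finset.mul_sum]

lemma mul_le_birkhoff (f : X → X) {ψ : X → ℝ} {m : ℝ} (hm : ∀ x, m ≤ ψ x) (n : ℕ) (x : X) :
    n * m ≤ birkhoff f ψ n x := by
  simpa [birkhoff] using Finset.card_nsmul_le_sum (Finset.range n) (fun i => ψ (f^[i] x)) m
    fun i _ => hm _

variable [MetricSpace X]

lemma inducedQ_const_mul_le (f : X → X) (ψ φ : X → ℝ) (T ε : ℝ) {β : ℝ} (hβ : 1 ≤ β) :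
    inducedQ f ψ (fun x => β * φ x) T ε ≤ inducedQ f ψ φ T ε ^ β := by
  have hβ0 : 0 < β := zero_lt_one.trans_le hβ
  rw [← ENNReal.rpow_inv_le_iff hβ0]
  refine le_iInf₂ fun F hF => ?_
  rw [ENNReal.rpow_inv_le_iff hβ0]
  refine (iInf₂_le F hF).trans ((ENNReal.tsum_le_tsum fun n => ?_).trans
    (ENNReal.tsum_rpow_le_rpow_tsum_of_one_le _ hβ))
  refine le_trans (Finset.sum_le_sum fun x _ => ?_)
    (ENNReal.sum_rpow_le_rpow_sum_of_one_le (F n) _ hβ)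
  rw [birkhoff_const_mul, mul_comm, Real.exp_mul,
    ENNReal.ofReal_rpow_of_pos (Real.exp_pos _)]

lemma inducedPressure_const_mul_le (f : X → X) (ψ φ : X → ℝ) {β : ℝ} (hβ : 1 ≤ β) :
    inducedPressure f ψ (fun x => β * φ x) ≤ (β : EReal) * inducedPressure f ψ φ := by
  have hβ0 : (0 : EReal) ≤ β := by exact_mod_cast zero_le_one.trans hβ
  unfold inducedPressure
  rw [← EReal.limsup_const_mul_of_nonneg_of_ne_top hβ0 (EReal.coe_ne_top β)]
  refine limsup_le_limsup (Eventually.of_forall fun ε => ?_)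
  dsimp only
  rw [← EReal.limsup_const_mul_of_nonneg_of_ne_top hβ0 (EReal.coe_ne_top β)]
  refine limsup_le_limsup ?_
  filter_upwards [eventually_ge_atTop (0 : ℝ)] with T hT
  rw [← mul_assoc, ← ENNReal.log_rpow]
  exact mul_le_mul_of_nonneg_right
    (ENNReal.log_le_log (inducedQ_const_mul_le f ψ φ T ε hβ))
    (by exact_mod_cast inv_nonneg.2 hT)

/-- A single orbit segment bounds `Q_{ψ,T}` from below. -/
lemma le_inducedQ_of_mem (f : X → X) {ψ φ : X → ℝ} {T ε η : ℝ}
    (hη : ∀ x y, dist x y ≤ ε → |φ x - φ y| ≤ η) {n : ℕ} {x : X}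
    (hx : x ∈ inducedXn f ψ T n) :
    ENNReal.ofReal (Real.exp (birkhoff f φ n x - n * η)) ≤ inducedQ f ψ φ T ε := by
  refine le_iInf₂ fun F hF => ?_
  have hn : n ∈ inducedST f ψ T := ⟨x, hx⟩
  obtain ⟨y, hyF, hy⟩ := hF n hn x hx
  have hle : birkhoff f φ n x - n * η ≤ birkhoff f φ n y := by
    have : birkhoff f φ n x - birkhoff f φ n y ≤ n * η := by
      simp only [birkhoff, ← Finset.sum_sub_distrib]
      simpa using Finset.sum_le_card_nsmul (Finset.range n)
        (fun i => φ (f^[i] x) - φ (f^[i] y)) η fun i hi => by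
          have := abs_le.1 (hη _ _ (hy i (Finset.mem_range.1 hi)))
          linarith
    linarith
  calc ENNReal.ofReal (Real.exp (birkhoff f φ n x - n * η))
      ≤ ENNReal.ofReal (Real.exp (birkhoff f φ n y)) :=
        ENNReal.ofReal_le_ofReal (Real.exp_le_exp.2 hle)
    _ ≤ ∑ z ∈ F n, ENNReal.ofReal (Real.exp (birkhoff f φ n z)) :=
        Finset.single_le_sum (f := fun z => ENNReal.ofReal (Real.exp (birkhoff f φ n z)))
          (fun _ _ => zero_le) hyF
    _ ≤ _ := ENNReal.le_tsum (f := fun k : inducedST f ψ T =>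
        ∑ z ∈ F k, ENNReal.ofReal (Real.exp (birkhoff f φ k z))) ⟨n, hn⟩

lemma exists_forall_pos_le [CompactSpace X] [Nonempty X] {ψ : X → ℝ} (hψ : Continuous ψ) (hψpos : ∀ x, 0 < ψ x) :
    ∃ m : ℝ, 0 < m ∧ ∀ x, m ≤ ψ x := by
  obtain ⟨x₀, -, hx₀⟩ := isCompact_univ.exists_isMinOn univ_nonempty hψ.continuousOn
  exact ⟨ψ x₀, hψpos x₀, fun x => hx₀ (mem_univ x)⟩

variable [MeasurableSpace X] [BorelSpace X]

lemma measurePreserving_of_mem_invMeasures {f : X → X} (hf : Continuous f) {μ : Measure X}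
    (hμ : μ ∈ invMeasures f) : MeasurePreserving f μ μ :=
  ⟨hf.measurable, Measure.ext fun B hB => by
    rw [Measure.map_apply hf.measurable hB, hμ.2 B hB]⟩

variable [CompactSpace X]

lemma Continuous.integrable_of_compactSpace_of_isFiniteMeasure {g : X → ℝ} (hg : Continuous g)
    (μ : Measure X) [IsFiniteMeasure μ] : Integrable g μ :=
  hg.integrable_of_hasCompactSupport (HasCompactSupport.of_compactSpace g)

lemma integral_birkhoff {f : X → X} (hf : Continuous f) {μ : Measure X}
    (hμ : μ ∈ invMeasures f) {g : X → ℝ} (hg : Continuous g) (n : ℕ) :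
    ∫ x, birkhoff f g n x ∂μ = n * ∫ x, g x ∂μ := by
  have := hμ.1
  have hmp := measurePreserving_of_mem_invMeasures hf hμ
  have h (i : ℕ) : ∫ x, g (f^[i] x) ∂μ = ∫ x, g x ∂μ := by
    have hi := hmp.iterate i
    conv_rhs => rw [← hi.map_eq]
    exact (integral_map hi.measurable.aemeasurable
      hg.measurable.aestronglyMeasurable).symm
  have hint (i : ℕ) : Integrable (fun x => g (f^[i] x)) μ :=
    (hg.comp (hf.iterate i)).integrable_of_compactSpace_of_isFiniteMeasure μ
  simp only [birkhoff]
  rw [integral_finsetSum _ fun i _ => hint i]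
  simp [h]

/-- Each invariant measure has points whose Birkhoff sums have at least the space-average ratio. -/
lemma exists_ratio_mul_birkhoff_le {f : X → X} (hf : Continuous f) {μ : Measure X}
    (hμ : μ ∈ invMeasures f) {ψ φ : X → ℝ} (hψ : Continuous ψ) (hφ : Continuous φ)
    (hpos : ∫ x, ψ x ∂μ ≠ 0) (n : ℕ) :
    ∃ x, (∫ y, φ y ∂μ) / (∫ y, ψ y ∂μ) * birkhoff f ψ n x ≤ birkhoff f φ n x := by
  have := hμ.1
  set a := (∫ y, φ y ∂μ) / (∫ y, ψ y ∂μ) with ha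
  have hg : Continuous fun x => φ x - a * ψ x := by fun_prop
  have hgn : Continuous (birkhoff f (fun x => φ x - a * ψ x) n) := by
    unfold birkhoff
    exact continuous_finsetSum _ fun i _ => hg.comp (hf.iterate i)
  obtain ⟨x, hx⟩ := exists_integral_le
    (hgn.integrable_of_compactSpace_of_isFiniteMeasure μ)
  refine ⟨x, ?_⟩
  rw [integral_birkhoff hf hμ hg, integral_sub
    (hφ.integrable_of_compactSpace_of_isFiniteMeasure μ)
    ((hψ.integrable_of_compactSpace_of_isFiniteMeasure μ).const_mul a),
    integral_const_mul, ha, div_mul_cancel₀ _ hpos, sub_self, mul_zero, ← ha] at hx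
  simp only [birkhoff, Finset.sum_sub_distrib, ← Finset.mul_sum] at hx ⊢
  linarith

lemma integral_pos_of_continuous_pos [Nonempty X] {ψ : X → ℝ} (hψ : Continuous ψ)
    (hψpos : ∀ x, 0 < ψ x) (μ : Measure X) [IsProbabilityMeasure μ] : 0 < ∫ x, ψ x ∂μ := by
  obtain ⟨m, hm0, hm⟩ := exists_forall_pos_le hψ hψpos
  calc 0 < m := hm0
    _ = ∫ _, m ∂μ := by simp
    _ ≤ _ := integral_mono (integrable_const m)
      (hψ.integrable_of_compactSpace_of_isFiniteMeasure μ) hm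

/-- The entropy-free half of the variational principle for the induced pressure. -/
lemma ratio_le_inducedPressure [Nonempty X] {f : X → X} (hf : Continuous f) {μ : Measure X}
    (hμ : μ ∈ invMeasures f) {ψ φ : X → ℝ} (hψ : Continuous ψ) (hφ : Continuous φ)
    (hψpos : ∀ x, 0 < ψ x) :
    (((∫ x, φ x ∂μ) / (∫ x, ψ x ∂μ) : ℝ) : EReal) ≤ inducedPressure f ψ φ := by
  have := hμ.1
  have hint := integral_pos_of_continuous_pos hψ hψpos μ
  obtain ⟨m, hm0, hm⟩ := exists_forall_pos_le hψ hψpos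
  have hpt := exists_ratio_mul_birkhoff_le hf hμ hψ hφ hint.ne'
  set a := (∫ x, φ x ∂μ) / (∫ x, ψ x ∂μ)
  choose x hx using hpt
  refine EReal.ge_of_forall_gt_iff_ge.1 fun c hc => ?_
  rw [EReal.coe_lt_coe_iff] at hc
  have hη : 0 < (a - c) * m := mul_pos (sub_pos.2 hc) hm0
  obtain ⟨δ, hδ0, hδ⟩ := Metric.uniformContinuous_iff.1
    (CompactSpace.uniformContinuous_of_continuous hφ) _ hη
  refine le_limsup_of_frequently_le' (Eventually.frequently ?_)
  filter_upwards [Ioo_mem_nhdsGT hδ0] with ε hε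
  have hmod : ∀ y z, dist y z ≤ ε → |φ y - φ z| ≤ (a - c) * m := fun y z h =>
    (hδ (h.trans_lt hε.2)).le
  have htend : Tendsto (fun n : ℕ => birkhoff f ψ n (x n)) atTop atTop :=
    tendsto_atTop_mono (fun n => mul_le_birkhoff f hm n (x n))
      (tendsto_natCast_atTop_atTop.atTop_mul_const hm0)
  refine le_limsup_of_frequently_le' (htend.frequently (Eventually.frequently ?_))
  filter_upwards [htend.eventually_gt_atTop 0] with n hT
  set T := birkhoff f ψ n (x n) with hTdef
  have hmem : x n ∈ inducedXn f ψ T n := by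
    refine ⟨le_rfl, ?_⟩
    rw [hTdef, birkhoff, birkhoff, Finset.sum_range_succ]
    linarith [hψpos (f^[n] (x n))]
  have hQ := ENNReal.log_le_log (le_inducedQ_of_mem f hmod hmem)
  rw [ENNReal.log_ofReal_of_pos (Real.exp_pos _), Real.log_exp] at hQ
  have hcT : c * T ≤ birkhoff f φ n (x n) - n * ((a - c) * m) := by
    have h1 := hx n
    have h2 := mul_le_mul_of_nonneg_left (mul_le_birkhoff f hm n (x n)) (sub_pos.2 hc).le
    rw [← hTdef] at h1 h2
    linarith
  have hTinv : (0 : EReal) ≤ ((T⁻¹ : ℝ) : EReal) := by exact_mod_cast (inv_pos.2 hT).le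
  calc (c : EReal) = ((c * T * T⁻¹ : ℝ) : EReal) := by rw [mul_inv_cancel_right₀ hT.ne']
    _ = ((c * T : ℝ) : EReal) * ((T⁻¹ : ℝ) : EReal) := EReal.coe_mul _ _
    _ ≤ _ := mul_le_mul_of_nonneg_right ((EReal.coe_le_coe_iff.2 hcT).trans hQ) hTinv

end Helpers

/-- If `μ ∈ M(X,f)` is an equilibrium state of `P_ψ(φ)` for some
continuous `φ` and `h_μ(f) = 0`, then `μ` is an equilibrium state of `P_ψ(βφ)` for
every `β ≥ 1`. -/
theorem zero_entropy_equilibrium_freezes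
    {X : Type*} [MetricSpace X] [CompactSpace X] [Nonempty X]
    [MeasurableSpace X] [BorelSpace X]
    (f : X → X) (hf : Continuous f)
    (ψ : X → ℝ) (hψ : Continuous ψ) (hψpos : ∀ x, 0 < ψ x)
    (htop : topEntropy f < ⊤)
    (μ : Measure X) (hμ : μ ∈ invMeasures f)
    (φ : X → ℝ) (hφ : Continuous φ)
    (heq : μ ∈ equilibriumStates f ψ φ) (hzero : measEntropy f μ = 0) :
    ∀ β : ℝ, 1 ≤ β → μ ∈ equilibriumStates f ψ (fun x => β * φ x) := by
  intro β hβ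
  refine ⟨hμ, ?_⟩
  have hP := heq.2
  rw [hzero, zero_add, ← EReal.coe_div] at hP ⊢
  refine le_antisymm ?_ (ratio_le_inducedPressure hf hμ hψ (hφ.const_mul β) hψpos)
  refine (inducedPressure_const_mul_le f ψ φ hβ).trans_eq ?_
  rw [hP, ← EReal.coe_mul, integral_const_mul, mul_div_assoc]
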